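/- arXiv:2503.01180 — 4 statements merged into one kernel-verified Lean document; each statement's English description precedes it below -/
import Mathlib

section
/- Let G and H be groups, let alpha be an automorphism of G, let beta be a group homomorphism from H to the center Z(G) of G, let gamma be a group homomorphism from G to the center Z(H) of H, and let delta be an automorphism of H. Then the map from G × H to G × H sending (g, h) to (alpha(g) * beta(h), gamma(g) * delta(h)) is a group homomorphism. -/
/-- For groups `G, H`, an automorphism `α` of `G`, a homomorphism
`β : H →* Z(G)`, a homomorphism `γ : G →* Z(H)` and an automorphism `δ` of `H`,
the map `(g, h) ↦ (α g * β h, γ g * δ h)` is a group homomorphism `G × H → G × H`. -/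
theorem matrix_map_is_hom
    (G H : Type*) [Group G] [Group H]
    (α : MulAut G) (β : H →* Subgroup.center G)
    (γ : G →* Subgroup.center H) (δ : MulAut H) :
    ∃ F : (G × H) →* (G × H),
      ∀ p : G × H, F p = (α p.1 * (β p.2 : G), (γ p.1 : H) * δ p.2) := by
  refine ⟨MonoidHom.mk' (fun p => (α p.1 * (β p.2 : G), (γ p.1 : H) * δ p.2)) ?_, fun _ => rfl⟩
  rintro ⟨g, h⟩ ⟨g', h'⟩
  have hβ : Commute (α g') (β h : G) := Subgroup.mem_center_iff.mp (β h).2 (α g')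
  have hγ : Commute (γ g' : H) (δ h) := (Subgroup.mem_center_iff.mp (γ g').2 (δ h)).symm
  simp only [Prod.mk_mul_mk, map_mul, Subgroup.coe_mul,
    hβ.mul_mul_mul_comm, hγ.mul_mul_mul_comm]
end

section
/- Let G and H be finite directly indecomposable groups that are not isomorphic. Then every automorphism psi of the direct product G × H maps the subgroup S = G × Z(H) onto itself: psi(S) = S. -/
/-- A group is *directly indecomposable* if it is nontrivial and whenever it is
isomorphic to a direct product `A × B` of two groups, one of `A`, `B` is trivial. -/
def DirectlyIndecomposable (G : Type u) [Group G] : Prop :=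
  Nontrivial G ∧
    ∀ (A B : Type u) [Group A] [Group B],
      Nonempty (G ≃* (A × B)) → (Subsingleton A ∨ Subsingleton B)

/-- Every element of a finite monoid has an idempotent positive power. -/
theorem exists_isIdempotentElem_pow {M : Type*} [Monoid M] [Finite M] (x : M) :
    ∃ n : ℕ, n ≠ 0 ∧ IsIdempotentElem (x ^ n) := by
  obtain ⟨a, d, hd, h⟩ : ∃ a d : ℕ, d ≠ 0 ∧ x ^ (a + d) = x ^ a := by
    obtain ⟨a, b, hab, h⟩ := Finite.exists_ne_map_eq_of_infinite (fun n : ℕ ↦ x ^ n)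
    rcases hab.lt_or_gt with hlt | hlt
    · exact ⟨a, b - a, by omega, by rw [Nat.add_sub_cancel' hlt.le]; exact h.symm⟩
    · exact ⟨b, a - b, by omega, by rw [Nat.add_sub_cancel' hlt.le]; exact h⟩
  have hper : ∀ j, x ^ (a + d * j) = x ^ a := by
    intro j
    induction j with
    | zero => simp
    | succ j ih => rw [show a + d * (j + 1) = a + d + d * j by ring, pow_add, h, ← pow_add, ih]
  refine ⟨d * (a + 1), by positivity, ?_⟩
  obtain ⟨c, hc⟩ : ∃ c, d * (a + 1) = a + c :=
    Nat.exists_eq_add_of_le (by nlinarith [Nat.pos_of_ne_zero hd])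
  calc x ^ (d * (a + 1)) * x ^ (d * (a + 1))
      = x ^ (a + d * (a + 1)) * x ^ c := by
        rw [← pow_add, ← pow_add]; congr 1; omega
    _ = x ^ (d * (a + 1)) := by rw [hper, ← pow_add, ← hc]

/-- **Fitting's lemma** for groups: an endomorphism of a finite directly indecomposable group that
commutes with conjugation is bijective or nilpotent. -/
theorem DirectlyIndecomposable.bijective_or_exists_iterate_eq_one {H : Type u} [Group H] [Finite H]
    (hH : DirectlyIndecomposable H) (ν : H →* H)
    (hν : ∀ k h, ν (k * h * k⁻¹) = k * ν h * k⁻¹) :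
    Function.Bijective ν ∨ ∃ n, ∀ x, ν^[n] x = 1 := by
  have : Finite (Monoid.End H) := Finite.of_injective (fun f : Monoid.End H ↦ (f : H → H))
    DFunLike.coe_injective
  let N : Monoid.End H := ν
  obtain ⟨n, hn, hidem⟩ := exists_isIdempotentElem_pow N
  let e : H →* H := (N ^ n : Monoid.End H)
  have hcoe : ∀ x, e x = ν^[n] x := fun x ↦ congrFun (Monoid.End.coe_pow H ν n) x
  have hee : ∀ x, e (e x) = e x := fun x ↦ DFunLike.congr_fun hidem x
  have hconj : ∀ k h, e (k * h * k⁻¹) = k * e h * k⁻¹ := by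
    intro k h
    simp only [hcoe]
    exact (Function.Semiconj.iterate_right (f := fun h ↦ k * h * k⁻¹) (fun h ↦ (hν k h).symm) n
      h).symm
  have hcomm : ∀ (x : e.ker) (y : e.range), Commute (x : H) (y : H) := by
    rintro ⟨x, hx⟩ ⟨_, y, rfl⟩
    rw [MonoidHom.mem_ker] at hx
    have h := hconj x (e y)
    rw [map_mul, map_mul, map_inv, hx, hee] at h
    simp only [one_mul, inv_one, mul_one] at h
    exact (eq_mul_inv_iff_mul_eq.mp h).symm
  let f : e.ker × e.range →* H := e.ker.subtype.noncommCoprod e.range.subtype hcomm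
  have hf : Function.Bijective f := by
    constructor
    · rw [injective_iff_map_eq_one]
      rintro ⟨⟨x, hx⟩, ⟨_, y, rfl⟩⟩ h
      have h : x * e y = 1 := h
      rw [MonoidHom.mem_ker] at hx
      have hy : e y = 1 := by simpa [hx, hee] using congrArg e h
      have hx : x = 1 := by simpa [hy] using h
      ext <;> simp [hx, hy]
    · intro h
      refine ⟨(⟨h * (e h)⁻¹, by simp [MonoidHom.mem_ker, hee]⟩, ⟨e h, h, rfl⟩), ?_⟩
      exact inv_mul_cancel_right h (e h)
  rcases hH.2 _ _ ⟨(MulEquiv.ofBijective f hf).symm⟩ with h | h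
  · left
    rw [← Finite.injective_iff_bijective, injective_iff_map_eq_one]
    intro x hx
    have hxe : x ∈ e.ker := by
      obtain ⟨m, rfl⟩ := Nat.exists_eq_succ_of_ne_zero hn
      rw [MonoidHom.mem_ker, hcoe, Function.iterate_succ_apply, hx, iterate_map_one]
    exact congrArg Subtype.val (Subsingleton.elim (⟨x, hxe⟩ : e.ker) 1)
  · right
    refine ⟨n, fun x ↦ ?_⟩
    rw [← hcoe]
    exact congrArg Subtype.val (Subsingleton.elim (⟨e x, x, rfl⟩ : e.range) 1)

section Components

variable {A B C D : Type*} [Group A] [Group B] [Group C] [Group D]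

/-- The endomorphism of `D` obtained by conjugating the projection of `A × B` onto `A` by an
isomorphism `A × B ≃* C × D`, and restricting to `D`. -/
def MulEquiv.throughFst (θ : A × B ≃* C × D) : D →* D :=
  (((MonoidHom.snd C D).comp θ.toMonoidHom).comp (MonoidHom.inl A B)).comp
    (((MonoidHom.fst A B).comp θ.symm.toMonoidHom).comp (MonoidHom.inr C D))

theorem MulEquiv.throughFst_apply (θ : A × B ≃* C × D) (d : D) :
    θ.throughFst d = (θ ((θ.symm (1, d)).1, 1)).2 := rfl

theorem MulEquiv.throughFst_conj (θ : A × B ≃* C × D) (k d : D) :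
    θ.throughFst (k * d * k⁻¹) = k * θ.throughFst d * k⁻¹ := by
  have h : ((1, k * d * k⁻¹) : C × D) = (1, k) * (1, d) * (1, k)⁻¹ := by simp
  have h' : ∀ a b : A × B, (((a * b * a⁻¹).1, 1) : A × B) = a * (b.1, 1) * a⁻¹ := by
    intro a b; ext <;> simp
  simp only [throughFst_apply, h]
  rw [map_mul, map_mul, map_inv, h', map_mul, map_mul, map_inv, θ.apply_symm_apply]
  simp

end Components

theorem snd_apply_inl_mem_center {G H : Type u} [Group G] [Group H] [Finite G] [Finite H]
    (hG : DirectlyIndecomposable G) (hH : DirectlyIndecomposable H)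
    (hiso : IsEmpty (G ≃* H)) (ψ : MulAut (G × H)) (g : G) :
    (ψ (g, 1)).2 ∈ Subgroup.center H := by
  let γ : G →* H := ((MonoidHom.snd G H).comp ψ.toMonoidHom).comp (MonoidHom.inl G H)
  let β : H →* G := ((MonoidHom.fst G H).comp ψ.symm.toMonoidHom).comp (MonoidHom.inr G H)
  let μ : H →* H := ((MonoidHom.snd G H).comp ψ.toMonoidHom).comp ((MonoidHom.inr G H).comp
    (((MonoidHom.snd G H).comp ψ.symm.toMonoidHom).comp (MonoidHom.inr G H)))
  have hsum : ∀ h, γ (β h) * μ h = h := by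
    intro h
    change (ψ ((ψ.symm (1, h)).1, 1)).2 * (ψ (1, (ψ.symm (1, h)).2)).2 = h
    rw [← Prod.snd_mul, ← map_mul]
    simp
  have hnil : ∃ n, ∀ x, (γ.comp β)^[n] x = 1 := by
    refine (hH.bijective_or_exists_iterate_eq_one (γ.comp β)
      (MulEquiv.throughFst_conj ψ)).resolve_left fun hb ↦ ?_
    have hsurj : Function.Surjective γ := .of_comp hb.2
    rcases hG.bijective_or_exists_iterate_eq_one (β.comp γ) (MulEquiv.throughFst_conj
      ((MulEquiv.prodComm.trans ψ.symm).trans MulEquiv.prodComm)) with hb' | ⟨n, hn⟩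
    · exact hiso.elim (MulEquiv.ofBijective γ ⟨.of_comp (f := β) hb'.1, hsurj⟩)
    · have := hH.1
      obtain ⟨h, hh⟩ := exists_ne (1 : H)
      obtain ⟨y, rfl⟩ := (hb.2.iterate n) h
      obtain ⟨x, rfl⟩ := hsurj y
      have hs : Function.Semiconj γ (β.comp γ) (γ.comp β) := fun _ ↦ rfl
      exact hh (by rw [← hs.iterate_right n x, hn, map_one])
  obtain ⟨n, hn⟩ := hnil
  have hμ : Function.Surjective μ := by
    rw [← Finite.injective_iff_surjective, injective_iff_map_eq_one]
    intro h hh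
    have hfix : (γ.comp β) h = h := by simpa [hh] using hsum h
    rw [← hn h, Function.iterate_fixed hfix]
  rw [Subgroup.mem_center_iff]
  intro k
  obtain ⟨h, rfl⟩ := hμ k
  change (ψ (1, (ψ.symm (1, h)).2)).2 * (ψ (g, 1)).2 = (ψ (g, 1)).2 * (ψ (1, (ψ.symm (1, h)).2)).2
  rw [← Prod.snd_mul, ← Prod.snd_mul, ← map_mul, ← map_mul]
  simp

/-- Let `G` and `H` be finite directly indecomposable groups that
are not isomorphic.  Then every automorphism `ψ` of `G × H` maps the subgroup
`S = G × Z(H)` onto itself: `ψ (S) = S`. -/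
theorem aut_preserves_S_of_not_iso
    (G H : Type u) [Group G] [Group H] [Finite G] [Finite H]
    (hG : DirectlyIndecomposable G) (hH : DirectlyIndecomposable H)
    (hiso : IsEmpty (G ≃* H)) (ψ : MulAut (G × H)) :
    Subgroup.map ψ.toMonoidHom ((⊤ : Subgroup G).prod (Subgroup.center H))
      = (⊤ : Subgroup G).prod (Subgroup.center H) := by
  have key : ∀ φ : MulAut (G × H), ∀ x ∈ (⊤ : Subgroup G).prod (Subgroup.center H),
      φ x ∈ (⊤ : Subgroup G).prod (Subgroup.center H) := by
    rintro φ ⟨g, z⟩ hx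
    have hz : z ∈ Subgroup.center H := (Subgroup.mem_prod.mp hx).2
    refine Subgroup.mem_prod.mpr ⟨Subgroup.mem_top _, ?_⟩
    have hsplit : ((g, z) : G × H) = (g, 1) * (1, z) := by simp
    rw [hsplit, map_mul, Prod.snd_mul]
    refine mul_mem (snd_apply_inl_mem_center hG hH hiso φ g) ?_
    rw [Subgroup.mem_center_iff]
    intro k
    obtain ⟨y, hy⟩ := φ.surjective (1, k)
    have hcomm : y * (1, z) = (1, z) * y := by
      ext
      · simp
      · simpa using Subgroup.mem_center_iff.mp hz y.2
    have h := congrArg (fun p ↦ (φ p).2) hcomm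
    simpa [hy] using h
  apply le_antisymm
  · rintro _ ⟨x, hx, rfl⟩
    exact key ψ x hx
  · intro x hx
    exact ⟨ψ.symm x, key ψ.symm x hx, ψ.apply_symm_apply x⟩
end

section
/- Let G and H be finite nonabelian directly indecomposable groups. Then G and H are isomorphic if and only if there exists an automorphism psi of the direct product G × H with psi(S) not equal to S, where S = G × Z(H). Equivalently, S is invariant under all automorphisms of G × H if and only if G is not isomorphic to H. -/
/-- Every element of a finite monoid has an idempotent positive power. -/
theorem exists_pos_pow_isIdempotentElem {M : Type*} [Monoid M] [Finite M] (f : M) :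
    ∃ n, 0 < n ∧ IsIdempotentElem (f ^ n) := by
  obtain ⟨a, b, hab, h⟩ : ∃ a b : ℕ, a < b ∧ f ^ a = f ^ b := by
    obtain ⟨a, b, hne, h⟩ := Finite.exists_ne_map_eq_of_infinite (fun n : ℕ => f ^ n)
    rcases hne.lt_or_gt with hlt | hlt
    · exact ⟨a, b, hlt, h⟩
    · exact ⟨b, a, hlt, h.symm⟩
  obtain ⟨d, rfl⟩ := Nat.exists_eq_add_of_lt hab
  have period : ∀ k j, a ≤ k → f ^ (k + j * (d + 1)) = f ^ k := by
    intro k j hk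
    obtain ⟨c, rfl⟩ := Nat.exists_eq_add_of_le hk
    induction j with
    | zero => simp
    | succ j ih =>
      rw [← ih, show a + c + (j + 1) * (d + 1) = (a + d + 1) + (c + j * (d + 1)) by ring,
        pow_add, ← h, ← pow_add]
      congr 1
      ring
  refine ⟨(a + 1) * (d + 1), by positivity, ?_⟩
  rw [IsIdempotentElem, ← pow_add]
  exact period _ _ (by nlinarith)

/-- A homomorphism from a directly indecomposable group which is split, up to an automorphism of
the target, by a homomorphism with normal range is trivial or injective. -/
theorem DirectlyIndecomposable.subsingleton_or_injective {G : Type u} {Q : Type*} [Group G]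
    [Group Q] (hG : DirectlyIndecomposable G) (p : G →* Q) (s : Q →* G)
    (hps : Function.Bijective (p.comp s)) (hs : s.range.Normal) :
    Subsingleton Q ∨ Function.Injective p := by
  have s_inj : Function.Injective s := fun x y hxy => hps.1 (congrArg p hxy)
  have disj : Disjoint p.ker s.range := by
    rw [Subgroup.disjoint_def]
    rintro _ hx ⟨q, rfl⟩
    rw [hps.1 ((show p (s q) = 1 from hx).trans (map_one (p.comp s)).symm), map_one]
  have comm : ∀ (x : p.ker) (y : s.range), Commute (p.ker.subtype x) (s.range.subtype y) :=
    fun x y => Subgroup.commute_of_normal_of_disjoint _ _ inferInstance hs disj _ _ x.2 y.2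
  let m : p.ker × s.range →* G := MonoidHom.noncommCoprod p.ker.subtype s.range.subtype comm
  have hm : Function.Bijective m := by
    refine ⟨(injective_iff_map_eq_one m).2 ?_, fun g => ?_⟩
    · rintro ⟨⟨x, hx⟩, ⟨y, hy⟩⟩ hxy
      have hxy : x * y = 1 := hxy
      have hy1 : y = 1 := Subgroup.disjoint_def.1 disj
        (by rw [eq_inv_of_mul_eq_one_right hxy]; exact inv_mem hx) hy
      have hx1 : x = 1 := by simpa [hy1] using hxy
      subst hy1 hx1
      rfl
    · obtain ⟨q, hq⟩ := hps.2 (p g)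
      have hq : p (s q) = p g := hq
      refine ⟨(⟨g * (s q)⁻¹, ?_⟩, ⟨s q, q, rfl⟩), ?_⟩
      · simp [MonoidHom.mem_ker, hq]
      · exact inv_mul_cancel_right g (s q)
  rcases hG.2 _ _ ⟨(MulEquiv.ofBijective m hm).symm⟩ with h | h
  · exact Or.inr ((MonoidHom.ker_eq_bot_iff p).1 (Subgroup.eq_bot_of_subsingleton _))
  · exact Or.inl ((MonoidHom.ofInjective s_inj).toEquiv.subsingleton)

/-- If the ranges of two homomorphisms commute and generate the group, both are normal. -/
theorem MonoidHom.range_normal_of_commute {G H K : Type*} [Group G] [Group H] [Group K]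
    (f : H →* G) (f' : K →* G) (comm : ∀ x y, Commute (f x) (f' y))
    (gen : ∀ g, ∃ x y, f x * f' y = g) : f.range.Normal := by
  constructor
  rintro _ ⟨x, rfl⟩ g
  obtain ⟨y, z, rfl⟩ := gen g
  refine ⟨y * x * y⁻¹, ?_⟩
  have := (comm x z).symm.mul_inv_cancel
  calc f (y * x * y⁻¹) = f y * (f' z * f x * (f' z)⁻¹) * (f y)⁻¹ := by rw [this]; simp
    _ = f y * f' z * f x * (f y * f' z)⁻¹ := by group

/-- If the identity of a finite directly indecomposable group is the pointwise product of two
endomorphisms with commuting images, one of them is injective. -/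
theorem DirectlyIndecomposable.injective_or_injective {H : Type u} [Group H] [Finite H]
    (hH : DirectlyIndecomposable H) (f f' : Monoid.End H)
    (comm : ∀ x y, Commute (f x) (f' y)) (hsum : ∀ x, f x * f' x = x) :
    Function.Injective f ∨ Function.Injective f' := by
  have : Finite (Monoid.End H) := DFunLike.finite _
  obtain ⟨n, hn, hidem⟩ := exists_pos_pow_isIdempotentElem f
  set e : H →* H := f ^ n with he
  have idem : ∀ x, e (e x) = e x := fun x => DFunLike.congr_fun hidem x
  have conj_f : ∀ y x, f (y * x * y⁻¹) = y * f x * y⁻¹ := by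
    intro y x
    have := (comm x y).symm.mul_inv_cancel
    calc f (y * x * y⁻¹) = f y * (f' y * f x * (f' y)⁻¹) * (f y)⁻¹ := by rw [this]; simp
      _ = (f y * f' y) * f x * (f y * f' y)⁻¹ := by group
      _ = y * f x * y⁻¹ := by rw [hsum]
  have e_apply : ∀ x, e x = f^[n] x := fun x => by
    rw [he]; exact congrFun (Monoid.End.coe_pow H f n) x
  have conj_e : ∀ y x, e (y * x * y⁻¹) = y * e x * y⁻¹ := by
    intro y x
    rw [e_apply, e_apply]
    exact ((Function.Semiconj.iterate_right (f := fun z => y * z * y⁻¹) (ga := f) (gb := f)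
      (fun z => (conj_f y z).symm) n).eq x).symm
  have normal : e.range.subtype.range.Normal := by
    rw [Subgroup.range_subtype]
    constructor
    rintro _ ⟨x, rfl⟩ y
    exact ⟨y * x * y⁻¹, conj_e y x⟩
  have split : e.rangeRestrict.comp e.range.subtype = MonoidHom.id _ := by
    ext ⟨_, x, rfl⟩
    exact idem x
  rcases hH.subsingleton_or_injective e.rangeRestrict e.range.subtype
    (by rw [split]; exact Function.bijective_id) normal with h | h
  · refine Or.inr ((injective_iff_map_eq_one f').2 fun x hx => ?_)
    have hfx : f x = x := by simpa [hx] using hsum x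
    have hex : e x = x := by rw [e_apply]; exact Function.iterate_fixed hfx n
    have := congrArg Subtype.val (Subsingleton.elim (e.rangeRestrict x) 1)
    exact hex.symm.trans this
  · left
    have e_inj : Function.Injective f^[n] := fun x y hxy =>
      h (Subtype.ext (by simpa [e_apply] using hxy))
    obtain ⟨k, rfl⟩ := Nat.exists_eq_succ_of_ne_zero hn.ne'
    exact Function.Injective.of_comp (f := f^[k]) (by rwa [← Function.iterate_succ])

/-- For directly indecomposable finite groups, an automorphism of `G × H` sending some element of
`G` to an element with noncentral second coordinate forces `G` and `H` to be isomorphic. -/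
theorem DirectlyIndecomposable.nonempty_mulEquiv {G H : Type u} [Group G] [Group H] [Finite H]
    (hG : DirectlyIndecomposable G) (hH : DirectlyIndecomposable H) (ψ : MulAut (G × H)) (g : G)
    (hg : (ψ (g, 1)).2 ∉ Subgroup.center H) : Nonempty (G ≃* H) := by
  have commute_inl_inr : ∀ (θ : MulAut (G × H)) x y, Commute (θ (x, 1)) (θ (1, y)) :=
    fun θ x y => (show Commute ((x, 1) : G × H) (1, y) by simp [Commute, SemiconjBy]).map θ
  have mul_inl_inr : ∀ (θ : MulAut (G × H)) x y, θ (x, 1) * θ (1, y) = θ (x, y) :=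
    fun θ x y => by rw [← map_mul]; simp
  let γ : G →* H := ((MonoidHom.snd G H).comp ψ.toMonoidHom).comp (MonoidHom.inl G H)
  let δ : H →* H := ((MonoidHom.snd G H).comp ψ.toMonoidHom).comp (MonoidHom.inr G H)
  let α' : G →* G := ((MonoidHom.fst G H).comp ψ.symm.toMonoidHom).comp (MonoidHom.inl G H)
  let β' : H →* G := ((MonoidHom.fst G H).comp ψ.symm.toMonoidHom).comp (MonoidHom.inr G H)
  let δ' : H →* H := ((MonoidHom.snd G H).comp ψ.symm.toMonoidHom).comp (MonoidHom.inr G H)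
  have comm : ∀ x y, Commute (γ x) (δ y) := fun x y =>
    (commute_inl_inr ψ x y).map (MonoidHom.snd G H)
  have hsum : ∀ x, γ (β' x) * δ (δ' x) = x := fun x => by
    have := congrArg Prod.snd (mul_inl_inr ψ (ψ.symm (1, x)).1 (ψ.symm (1, x)).2)
    rwa [Prod.mk.eta, MulEquiv.apply_symm_apply] at this
  rcases hH.injective_or_injective (γ.comp β') (δ.comp δ') (fun x y => comm _ _) hsum with h | h
  · have normal : β'.range.Normal := by
      refine MonoidHom.range_normal_of_commute β' α'
        (fun x y => ((commute_inl_inr ψ.symm y x).map (MonoidHom.fst G H)).symm) fun x => ?_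
      refine ⟨(ψ (x, 1)).2, (ψ (x, 1)).1, ?_⟩
      have comm' := (commute_inl_inr ψ.symm (ψ (x, 1)).1 (ψ (x, 1)).2).map (MonoidHom.fst G H)
      have := congrArg Prod.fst (mul_inl_inr ψ.symm (ψ (x, 1)).1 (ψ (x, 1)).2)
      rw [Prod.mk.eta, MulEquiv.symm_apply_apply] at this
      exact comm'.symm.eq.trans this
    have bij : Function.Bijective (γ.comp β') := Finite.injective_iff_bijective.1 h
    rcases hG.subsingleton_or_injective γ β' bij normal with h' | h'
    · exact absurd h' (not_subsingleton_iff_nontrivial.2 hH.1)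
    · exact ⟨MulEquiv.ofBijective γ ⟨h', Function.Surjective.of_comp bij.2⟩⟩
  · refine absurd (Subgroup.mem_center_iff.2 fun y => ?_) hg
    obtain ⟨x, rfl⟩ := Function.Surjective.of_comp (f := δ) (Finite.injective_iff_surjective.1 h) y
    exact (comm g x).symm.eq

/-- Let `G` and `H` be finite nonabelian directly indecomposable
groups.  Then `G ≃ H` if and only if some automorphism `ψ` of `G × H` satisfies
`ψ (S) ≠ S`, where `S = G × Z(H)`.  Equivalently, `S` is invariant under all
automorphisms of `G × H` if and only if `G` is not isomorphic to `H`. -/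
theorem iso_iff_exists_aut_moving_S
    (G H : Type u) [Group G] [Group H] [Finite G] [Finite H]
    (hG : DirectlyIndecomposable G) (hH : DirectlyIndecomposable H)
    (hGna : ∃ a b : G, a * b ≠ b * a) (hHna : ∃ a b : H, a * b ≠ b * a) :
    (Nonempty (G ≃* H) ↔
        ∃ ψ : MulAut (G × H),
          Subgroup.map ψ.toMonoidHom ((⊤ : Subgroup G).prod (Subgroup.center H))
            ≠ (⊤ : Subgroup G).prod (Subgroup.center H))
    ∧ ((∀ ψ : MulAut (G × H),
          Subgroup.map ψ.toMonoidHom ((⊤ : Subgroup G).prod (Subgroup.center H))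
            = (⊤ : Subgroup G).prod (Subgroup.center H)) ↔
        IsEmpty (G ≃* H)) := by
  have key : Nonempty (G ≃* H) ↔
      ∃ ψ : MulAut (G × H),
        Subgroup.map ψ.toMonoidHom ((⊤ : Subgroup G).prod (Subgroup.center H))
          ≠ (⊤ : Subgroup G).prod (Subgroup.center H) := by
    constructor
    · rintro ⟨e⟩
      refine ⟨MulEquiv.prodComm.trans (e.symm.prodCongr e), fun h => ?_⟩
      obtain ⟨a, b, hab⟩ := hHna
      have hb : ((1, b) : G × H) ∈ (⊤ : Subgroup G).prod (Subgroup.center H) := by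
        rw [← h]
        exact ⟨(e.symm b, 1), ⟨trivial, one_mem _⟩, Prod.ext (map_one e.symm) (e.apply_symm_apply b)⟩
      exact hab (Subgroup.mem_center_iff.1 hb.2 a)
    · rintro ⟨ψ, hψ⟩
      by_contra hGH
      have hle : Subgroup.map ψ.toMonoidHom ((⊤ : Subgroup G).prod (Subgroup.center H))
          ≤ (⊤ : Subgroup G).prod (Subgroup.center H) := by
        rintro _ ⟨⟨g, z⟩, ⟨-, hz⟩, rfl⟩
        refine ⟨trivial, ?_⟩
        have hg : (ψ (g, 1)).2 ∈ Subgroup.center H := by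
          by_contra hg
          exact hGH (hG.nonempty_mulEquiv hH ψ g hg)
        have hz' : (ψ (1, z)).2 ∈ Subgroup.center H := by
          refine Subgroup.mem_center_iff.2 fun y => ?_
          have hc : ((1, z) : G × H) * ψ.symm (1, y) = ψ.symm (1, y) * (1, z) :=
            Prod.ext (by simp) (Subgroup.mem_center_iff.1 hz _).symm
          have := congrArg (fun x => (ψ x).2) hc
          simpa using this.symm
        have hmul : ψ (g, z) = ψ (g, 1) * ψ (1, z) := by rw [← map_mul]; simp
        change (ψ (g, z)).2 ∈ Subgroup.center H
        rw [hmul]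
        exact mul_mem hg hz'
      exact hψ (Subgroup.eq_of_le_of_card_ge hle
        (Subgroup.card_map_of_injective ψ.injective).ge)
  refine ⟨key, ?_⟩
  rw [← not_nonempty_iff, key]
  push Not
  rfl
end

section
/- Let G and H be finite directly indecomposable groups, and let psi be an automorphism of the direct product G × H such that psi(S) is not equal to S, where S = G × Z(H). Then the map from G to H sending g to the second component of psi(g, 1) is a group isomorphism from G onto H. -/
/-- Some positive power of an element of a finite monoid is idempotent. -/
theorem exists_pow_succ_isIdempotentElem {M : Type*} [Monoid M] [Finite M] (f : M) :
    ∃ n : ℕ, IsIdempotentElem (f ^ (n + 1)) := by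
  obtain ⟨a, b, hne, hab⟩ := Finite.exists_ne_map_eq_of_infinite (fun n : ℕ ↦ f ^ n)
  wlog hlt : a < b generalizing a b
  · exact this b a hne.symm hab.symm (by omega)
  obtain ⟨d, rfl⟩ : ∃ d, b = a + (d + 1) := ⟨b - a - 1, by omega⟩
  have period : ∀ k j : ℕ, f ^ (a + j + k * (d + 1)) = f ^ (a + j) := by
    intro k
    induction k with
    | zero => simp
    | succ k ih =>
      intro j
      have h : a + j + (k + 1) * (d + 1) = (a + (d + 1)) + (j + k * (d + 1)) := by ring
      rw [h, pow_add, ← show f ^ a = f ^ (a + (d + 1)) from hab, ← pow_add, ← add_assoc, ih]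
  refine ⟨a * (d + 1) + d, ?_⟩
  have h := period (a + 1) (a * d + d + 1)
  have h₁ : a + (a * d + d + 1) = a * (d + 1) + d + 1 := by ring
  have h₂ : a * (d + 1) + d + 1 + (a + 1) * (d + 1) =
      (a * (d + 1) + d + 1) + (a * (d + 1) + d + 1) := by ring
  rwa [h₁, h₂, pow_add] at h

/-- An idempotent endomorphism commuting with all inner automorphisms splits the group as the
direct product of its kernel and its range. -/
theorem nonempty_mulEquiv_ker_prod_range {H : Type*} [Group H] (p : H →* H)
    (idem : ∀ x, p (p x) = p x) (normal : ∀ k x, p (k * x * k⁻¹) = k * p x * k⁻¹) :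
    Nonempty (H ≃* p.ker × p.range) := by
  have comm : ∀ (k : p.ker) (y : p.range), Commute (p.ker.subtype k) (p.range.subtype y) := by
    rintro ⟨k, hk⟩ ⟨_, x, rfl⟩
    have h := normal k x
    rw [map_mul, map_mul, map_inv, MonoidHom.mem_ker.1 hk, one_mul, inv_one, mul_one] at h
    exact (eq_mul_inv_iff_mul_eq.1 h).symm
  refine ⟨(MulEquiv.ofBijective (MonoidHom.noncommCoprod _ _ comm) ⟨?_, ?_⟩).symm⟩
  · rw [injective_iff_map_eq_one]
    rintro ⟨⟨k, hk⟩, ⟨_, x, rfl⟩⟩ h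
    have h' : k * p x = 1 := h
    have hx : p x = 1 := by
      simpa [MonoidHom.mem_ker.1 hk, idem] using congrArg p h'
    have hk' : k = 1 := by simpa [hx] using h'
    ext
    · exact hk'
    · exact hx
  · intro x
    refine ⟨(⟨x * (p x)⁻¹, by simp [MonoidHom.mem_ker, idem]⟩, ⟨p x, x, rfl⟩), ?_⟩
    simp

/-- **Fitting's lemma** for finite directly indecomposable groups: an endomorphism commuting with
all inner automorphisms is bijective or nilpotent. -/
theorem DirectlyIndecomposable.bijective_or_nilpotent {H : Type u} [Group H] [Finite H]
    (hH : DirectlyIndecomposable H) (f : H →* H)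
    (normal : ∀ k x, f (k * x * k⁻¹) = k * f x * k⁻¹) :
    Function.Bijective f ∨ ∃ n : ℕ, ∀ x, f^[n] x = 1 := by
  have : Finite (Monoid.End H) :=
    Finite.of_injective (fun (g : H →* H) x ↦ g x) DFunLike.coe_injective
  have normal_iterate : ∀ m k x, f^[m] (k * x * k⁻¹) = k * f^[m] x * k⁻¹ := by
    intro m k x
    induction m with
    | zero => rfl
    | succ m ih => simp only [Function.iterate_succ_apply', ih, normal]
  obtain ⟨n, p, coe_p, idem⟩ :
      ∃ (n : ℕ) (p : H →* H), ⇑p = f^[n + 1] ∧ ∀ x, p (p x) = p x := by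
    obtain ⟨n, hn⟩ := exists_pow_succ_isIdempotentElem (M := Monoid.End H) f
    exact ⟨n, HPow.hPow (α := Monoid.End H) f (n + 1), Monoid.End.coe_pow H f (n + 1),
      fun x ↦ DFunLike.congr_fun hn x⟩
  have split := nonempty_mulEquiv_ker_prod_range p idem
    (by simpa only [coe_p] using normal_iterate (n + 1))
  rcases hH.2 _ _ split with h | h
  · left
    refine Finite.injective_iff_bijective.1 ((injective_iff_map_eq_one f).2 fun x hx ↦ ?_)
    have hx' : x ∈ p.ker := by
      rw [MonoidHom.mem_ker, coe_p, Function.iterate_succ_apply, hx, iterate_map_one]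
    exact congrArg Subtype.val (Subsingleton.elim (⟨x, hx'⟩ : p.ker) 1)
  · right
    refine ⟨n + 1, fun x ↦ ?_⟩
    rw [← coe_p]
    exact congrArg Subtype.val (Subsingleton.elim (⟨p x, x, rfl⟩ : p.range) 1)

/-- If the identity is a pointwise product of two endomorphisms with commuting images, the second
factor commutes with all inner automorphisms. -/
theorem map_conj_of_mul_eq_self {H : Type*} [Group H] (e f : H →* H)
    (hef : ∀ x, e x * f x = x) (comm : ∀ x y, Commute (e x) (f y)) (k x : H) :
    f (k * x * k⁻¹) = k * f x * k⁻¹ := by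
  calc f (k * x * k⁻¹) = e k * f (k * x * k⁻¹) * (e k)⁻¹ := by
        rw [(comm k _).eq, mul_inv_cancel_right]
    _ = (e k * f k) * f x * (e k * f k)⁻¹ := by simp only [map_mul, map_inv]; group
    _ = k * f x * k⁻¹ := by rw [hef]

/-- Let `G` and `H` be finite directly indecomposable groups and
`ψ` an automorphism of `G × H` with `ψ (S) ≠ S`, where `S = G × Z(H)`.  Then the
map `g ↦ (ψ (g, 1)).2` is a group isomorphism from `G` onto `H`. -/
theorem iso_from_aut_moving_S
    (G H : Type u) [Group G] [Group H] [Finite G] [Finite H]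
    (hG : DirectlyIndecomposable G) (hH : DirectlyIndecomposable H)
    (ψ : MulAut (G × H))
    (hψ : Subgroup.map ψ.toMonoidHom ((⊤ : Subgroup G).prod (Subgroup.center H))
        ≠ (⊤ : Subgroup G).prod (Subgroup.center H)) :
    ∃ e : G ≃* H, ∀ g : G, e g = (ψ (g, 1)).2 := by
  let γ : G →* H := (MonoidHom.snd G H).comp (ψ.toMonoidHom.comp (MonoidHom.inl G H))
  let δ : H →* H := (MonoidHom.snd G H).comp (ψ.toMonoidHom.comp (MonoidHom.inr G H))
  let α : G →* G := (MonoidHom.fst G H).comp (ψ.toMonoidHom.comp (MonoidHom.inl G H))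
  let α' : G →* G := (MonoidHom.fst G H).comp (ψ.symm.toMonoidHom.comp (MonoidHom.inl G H))
  let β' : H →* G := (MonoidHom.fst G H).comp (ψ.symm.toMonoidHom.comp (MonoidHom.inr G H))
  let δ' : H →* H := (MonoidHom.snd G H).comp (ψ.symm.toMonoidHom.comp (MonoidHom.inr G H))
  have comm_inl_inr : ∀ (φ : G × H ≃* G × H) (g : G) (h : H),
      Commute (φ (g, 1)) (φ (1, h)) := fun φ g h ↦
    (show Commute (g, (1 : H)) (1, h) by simp [Commute, SemiconjBy]).map φ
  have comm_δγ : ∀ h g, Commute (δ h) (γ g) := fun h g ↦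
    ((comm_inl_inr ψ g h).map (MonoidHom.snd G H)).symm
  have comm_inv : ∀ g h, Commute (α' g) (β' h) := fun g h ↦
    (comm_inl_inr ψ.symm g h).map (MonoidHom.fst G H)
  have sum_H : ∀ h, δ (δ' h) * γ (β' h) = h := fun h ↦ by
    have key : ψ (1, δ' h) * ψ (β' h, 1) = (1, h) := by
      rw [← map_mul, ← ψ.apply_symm_apply (1, h)]
      congr 1
      simp [β', δ']
    exact congrArg Prod.snd key
  have sum_G : ∀ g, α' (α g) * β' (γ g) = g := fun g ↦ by
    have key : ψ.symm (α g, 1) * ψ.symm (1, γ g) = (g, 1) := by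
      rw [← map_mul, ← ψ.symm_apply_apply (g, 1)]
      congr 1
      simp [α, γ]
    exact congrArg Prod.fst key
  suffices hγ : Function.Bijective γ from ⟨MulEquiv.ofBijective γ hγ, fun _ ↦ rfl⟩
  rcases hH.bijective_or_nilpotent (γ.comp β') (map_conj_of_mul_eq_self (δ.comp δ') (γ.comp β')
    sum_H fun x y ↦ comm_δγ _ _) with hbij | ⟨n, hn⟩
  · have surj : Function.Surjective γ := Function.Surjective.of_comp hbij.2
    refine ⟨?_, surj⟩
    rcases hG.bijective_or_nilpotent (β'.comp γ) (map_conj_of_mul_eq_self (α'.comp α) (β'.comp γ)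
      sum_G fun x y ↦ comm_inv _ _) with hbij' | ⟨n, hn⟩
    · exact Function.Injective.of_comp (f := β') hbij'.1
    · obtain ⟨h, hh⟩ := @exists_ne H hH.1 1
      obtain ⟨h', rfl⟩ := hbij.2.iterate n h
      obtain ⟨g, rfl⟩ := surj h'
      have semi : Function.Semiconj γ (β'.comp γ) (γ.comp β') := fun _ ↦ rfl
      have key := (semi.iterate_right n) g
      exact absurd (key.symm.trans ((congrArg γ (hn g)).trans (map_one γ))) hh
  · have inj : Function.Injective (δ.comp δ') := by
      refine (injective_iff_map_eq_one _).2 fun x hx ↦ ?_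
      have fixed : Function.IsFixedPt (γ.comp β') x := by
        have h := sum_H x
        rwa [show δ (δ' x) = 1 from hx, one_mul] at h
      exact (fixed.iterate n).symm.trans (hn x)
    have surj : Function.Surjective δ :=
      Function.Surjective.of_comp (Finite.injective_iff_surjective.1 inj)
    refine absurd (Subgroup.eq_of_le_of_card_ge ?_ ?_) hψ
    · rintro _ ⟨⟨g, z⟩, hz, rfl⟩
      refine ⟨Subgroup.mem_top _, ?_⟩
      have hz' : z ∈ Subgroup.center H := hz.2
      have key : (ψ (g, z)).2 = γ g * δ z := by
        have h : ψ (g, z) = ψ (g, 1) * ψ (1, z) := by rw [← map_mul]; simp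
        exact congrArg Prod.snd h
      change (ψ (g, z)).2 ∈ Subgroup.center H
      rw [key]
      refine mul_mem ?_ ?_ <;> rw [Subgroup.mem_center_iff] <;> intro y <;>
        obtain ⟨x, rfl⟩ := surj y
      · exact comm_δγ x g
      · rw [← map_mul, ← map_mul, Subgroup.mem_center_iff.1 hz' x]
    · exact (Subgroup.card_map_of_injective ψ.injective).ge
end
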